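/- Let q = 2^s. The set H = {ξ_0, ξ_1, ..., ξ_m, e_1, ..., e_m} is a homogeneous system of parameters for the invariant ring S_m[z]^{O_{2m+1}(F_q)}: the variety in V ⊗ F̄_q cut out by the ideal generated by H is {0}. -/

import Mathlib

open MvPolynomial
open scoped Classical

/-- Variable index set for `S_m[z] = F_q[y_1,…,y_m,x_m,…,x_1,z]`:
`none` is `z`, `some (inl j)` is `y_j`, `some (inr j)` is `x_j`. -/
abbrev OIdx (m : ℕ) := Option (Fin m ⊕ Fin m)

/-- The complete Steenrod operator `P(t)`, the algebra homomorphism determined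
by `v ↦ v + v^q t` on degree-one elements; `P^k f = (stP q σ F f).coeff k`. -/
noncomputable def stP (q : ℕ) (σ : Type*) (F : Type*) [Field F] :
    MvPolynomial σ F →ₐ[F] Polynomial (MvPolynomial σ F) :=
  MvPolynomial.aeval fun i =>
    Polynomial.C (MvPolynomial.X i) + Polynomial.C (MvPolynomial.X i ^ q) * Polynomial.X

/-- The quadratic form `ξ_0 = z^2 + Σ x_j y_j`. -/
noncomputable def xiZero (m : ℕ) (F : Type*) [Field F] : MvPolynomial (OIdx m) F :=
  X none ^ 2 + ∑ j : Fin m, X (some (Sum.inr j)) * X (some (Sum.inl j))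

/-- `ξ̄_0 = Σ_j x_j y_j`. -/
noncomputable def xiBar (m : ℕ) (F : Type*) [Field F] : MvPolynomial (OIdx m) F :=
  ∑ j : Fin m, X (some (Sum.inr j)) * X (some (Sum.inl j))

/-- `ξ_i = Σ_j (x_j y_j^{q^i} + y_j x_j^{q^i})` for `i ≥ 1`. -/
noncomputable def xiGen (q m : ℕ) (F : Type*) [Field F] (i : ℕ) : MvPolynomial (OIdx m) F :=
  ∑ j : Fin m, (X (some (Sum.inr j)) * X (some (Sum.inl j)) ^ q ^ i
    + X (some (Sum.inl j)) * X (some (Sum.inr j)) ^ q ^ i)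

/-- The sum of the natural monomials attached to a finite set `T` of base-`q`
exponents: the sum over all perfect matchings of `T` (fixed-point-free
involutions `π` of `T`) of the products `Π_{a < π a} ξ_{π a - a}^{q^a}`. -/
noncomputable def natSum (q m : ℕ) (F : Type*) [Field F] (T : Finset ℕ) :
    MvPolynomial (OIdx m) F :=
  ∑ π ∈ Finset.univ.filter
      (fun π : Equiv.Perm {x : ℕ // x ∈ T} => (∀ a, π (π a) = a) ∧ ∀ a, π a ≠ a),
    ∏ a ∈ Finset.univ.filter (fun a : {x : ℕ // x ∈ T} => (a : ℕ) < (π a : ℕ)),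
      xiGen q m F ((π a : ℕ) - (a : ℕ)) ^ q ^ (a : ℕ)

/-- `u_m`, the sum of all natural monomials of degree `1 + q + ⋯ + q^{2m-1}`
and natural degree `m` (equal to the Moore determinant in the `2m` symplectic
variables). -/
noncomputable def uM (q m : ℕ) (F : Type*) [Field F] : MvPolynomial (OIdx m) F :=
  natSum q m F (Finset.range (2 * m))

/-- `u_{m-1}`, interpreted inside `S_m` via the natural monomials on the
exponent set `{0,…,2m-3}`. -/
noncomputable def uM1 (q m : ℕ) (F : Type*) [Field F] : MvPolynomial (OIdx m) F :=
  natSum q m F (Finset.range (2 * m - 2))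

/-- `δ_1 = Σ_{0<j<k<2m-1} ξ_j ξ_k δ_{jk}` where `δ_{jk}` is the sum of natural
monomials on the exponent set `{1,…,2m-2} \ {j,k}`. -/
noncomputable def deltaOne (q m : ℕ) (F : Type*) [Field F] : MvPolynomial (OIdx m) F :=
  ∑ j ∈ Finset.Icc 1 (2 * m - 2), ∑ k ∈ Finset.Icc 1 (2 * m - 2),
    if j < k then
      xiGen q m F j * xiGen q m F k *
        natSum q m F (((Finset.Icc 1 (2 * m - 2)).erase j).erase k)
    else 0

/-- The product `Π_{v ∈ F_q^{2m}} (t + ℓ_v)` over all linear forms in the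
symplectic variables; its coefficient of `t^{q^{2m-i}}` is the Dickson
invariant `d_{i,m}` of `GL_{2m}(F_q)`. -/
noncomputable def dickP (m : ℕ) (F : Type*) [Field F] [Fintype F] :
    Polynomial (MvPolynomial (OIdx m) F) :=
  ∏ c : (Fin m ⊕ Fin m) → F,
    (Polynomial.X + Polynomial.C (∑ i, MvPolynomial.C (c i) * X (some i)))

/-- The orthogonal invariants: `eSeq … b1 (i-1) = e_i`, where
`e_1 = u_m^{q/2-1} u_{m-1}^{q/2} z + b_1` and
`e_{i+1} = P^{q^{2m-1-i}/2}(e_i)`. -/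
noncomputable def eSeq (q m s : ℕ) (F : Type*) [Field F]
    (b1 : MvPolynomial (OIdx m) F) : ℕ → MvPolynomial (OIdx m) F
  | 0 => uM q m F ^ (2 ^ (s - 1) - 1) * uM1 q m F ^ 2 ^ (s - 1) * X none + b1
  | k + 1 => ((stP q (OIdx m) F) (eSeq q m s F b1 k)).coeff
      (2 ^ (s * (2 * m - 2 - k) - 1))

section LinearizedPolynomials

/-- The linearized polynomial `∑_{i ≤ n} a_i t^{q^i}`. -/
noncomputable def linearizedPoly (F : Type*) [Fintype F] {A : Type*} [CommRing A] (a : ℕ → A)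
    (n : ℕ) : Polynomial A :=
  ∑ i ∈ Finset.range (n + 1), Polynomial.C (a i) * Polynomial.X ^ Fintype.card F ^ i

lemma eval_linearizedPoly {F : Type*} [Fintype F] {A : Type*} [CommRing A] (a : ℕ → A) (n : ℕ)
    (x : A) :
    (linearizedPoly F a n).eval x = ∑ i ∈ Finset.range (n + 1), a i * x ^ Fintype.card F ^ i := by
  simp [linearizedPoly, Polynomial.eval_finsetSum]

variable {F : Type*} [Field F] [Fintype F]

lemma one_lt_fieldCard : 1 < Fintype.card F := Fintype.one_lt_card

lemma add_pow_card_field_pow {A : Type*} [CommRing A] [Algebra F A] (i : ℕ) (x y : A) :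
    (x + y) ^ Fintype.card F ^ i = x ^ Fintype.card F ^ i + y ^ Fintype.card F ^ i := by
  induction i with
  | zero => simp
  | succ i ih =>
    simpa [pow_succ, pow_mul, ih] using map_add (FiniteField.frobeniusAlgHom F A)
      (x ^ Fintype.card F ^ i) (y ^ Fintype.card F ^ i)

lemma smul_pow_card_field_pow {A : Type*} [CommRing A] [Algebra F A] (i : ℕ) (c : F) (x : A) :
    (c • x) ^ Fintype.card F ^ i = c • x ^ Fintype.card F ^ i := by
  rw [smul_pow, FiniteField.pow_card_pow]

lemma sum_pow_card_field_pow {A ι : Type*} [CommRing A] [Algebra F A] (i : ℕ)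
    (S : Finset ι) (f : ι → A) :
    (∑ j ∈ S, f j) ^ Fintype.card F ^ i = ∑ j ∈ S, f j ^ Fintype.card F ^ i := by
  induction S using Finset.induction_on with
  | empty => simp [Fintype.card_ne_zero]
  | insert a S ha ih => rw [Finset.sum_insert ha, Finset.sum_insert ha, add_pow_card_field_pow, ih]

lemma prod_X_add_C_smul {A : Type*} [CommRing A] [IsDomain A] [Algebra F A] (a : A) :
    ∏ c : F, (Polynomial.X + Polynomial.C (c • a)) =
      Polynomial.X ^ Fintype.card F
        - Polynomial.C (a ^ (Fintype.card F - 1)) * Polynomial.X := by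
  have hq : 1 < Fintype.card F := one_lt_fieldCard
  rcases eq_or_ne a 0 with rfl | ha
  · simp [Nat.sub_ne_zero_of_lt hq]
  rw [← sub_eq_zero]
  have hmon : (∏ c : F, (Polynomial.X + Polynomial.C (c • a))).Monic :=
    Polynomial.monic_prod_of_monic _ _ fun c _ => Polynomial.monic_X_add_C _
  have hdeg : (∏ c : F, (Polynomial.X + Polynomial.C (c • a))).degree =
      (Fintype.card F : WithBot ℕ) := by
    rw [Polynomial.degree_prod]
    simp
  have hlow : (Polynomial.C (a ^ (Fintype.card F - 1)) * Polynomial.X : Polynomial A).degree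
      < (Fintype.card F : WithBot ℕ) :=
    (Polynomial.degree_C_mul_X_le _).trans_lt (by exact_mod_cast hq)
  have hdeg' : (Polynomial.X ^ Fintype.card F
      - Polynomial.C (a ^ (Fintype.card F - 1)) * Polynomial.X : Polynomial A).degree
      = (Fintype.card F : WithBot ℕ) := by
    rw [Polynomial.degree_sub_eq_left_of_degree_lt, Polynomial.degree_X_pow]
    rwa [Polynomial.degree_X_pow]
  refine Polynomial.eq_zero_of_degree_lt_of_eval_finset_eq_zero
    (Finset.univ.image fun c : F => c • a) ?_ ?_
  · have hinj : Function.Injective fun c : F => c • a := smul_left_injective F ha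
    rw [Finset.card_image_of_injective _ hinj, Finset.card_univ]
    calc _ < (∏ c : F, (Polynomial.X + Polynomial.C (c • a))).degree := by
          refine Polynomial.degree_sub_lt_left (hdeg.trans hdeg'.symm) hmon.ne_zero ?_
          rw [hmon.leadingCoeff, Polynomial.leadingCoeff_sub_of_degree_lt]
          · simp
          · rwa [Polynomial.degree_X_pow]
      _ = _ := hdeg
  · intro x hx
    obtain ⟨c, -, rfl⟩ := Finset.mem_image.1 hx
    have h1 : (∏ d : F, (Polynomial.X + Polynomial.C (d • a))).eval (c • a) = 0 := by
      rw [Polynomial.eval_prod]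
      refine Finset.prod_eq_zero (Finset.mem_univ (-c)) ?_
      simp
    have h2 := smul_pow_card_field_pow 1 c a
    simp only [pow_one] at h2
    rw [Polynomial.eval_sub, h1]
    simp only [Polynomial.eval_sub, Polynomial.eval_pow, Polynomial.eval_X, Polynomial.eval_mul,
      Polynomial.eval_C, h2]
    rw [mul_smul_comm, pow_sub_one_mul (by omega)]
    simp

lemma prod_add_smul {A : Type*} [CommRing A] [IsDomain A] [Algebra F A] (Y a : A) :
    ∏ c : F, (Y + c • a) = Y ^ Fintype.card F - a ^ (Fintype.card F - 1) * Y := by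
  simpa [Polynomial.eval_prod] using congrArg (Polynomial.eval Y) (prod_X_add_C_smul (F := F) a)

lemma eval_linearizedPoly_smul {A : Type*} [CommRing A] [Algebra F A] (a : ℕ → A) (n : ℕ) (c : F)
    (x : A) :
    (linearizedPoly F a n).eval (c • x) = c • (linearizedPoly F a n).eval x := by
  simp only [eval_linearizedPoly, smul_pow_card_field_pow, Finset.smul_sum, mul_smul_comm]

lemma linearizedPoly_comp_X_add_C {A : Type*} [CommRing A] [Algebra F A] (a : ℕ → A) (n : ℕ)
    (x : A) :
    (linearizedPoly F a n).comp (Polynomial.X + Polynomial.C x)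
      = linearizedPoly F a n + Polynomial.C ((linearizedPoly F a n).eval x) := by
  simp only [eval_linearizedPoly, map_sum]
  simp only [linearizedPoly, Polynomial.sum_comp, ← Finset.sum_add_distrib]
  refine Finset.sum_congr rfl fun i _ => ?_
  simp [add_pow_card_field_pow, mul_add]

lemma coeff_linearizedPoly {A : Type*} [CommRing A] (a : ℕ → A) {n i : ℕ} (hi : i ≤ n) :
    (linearizedPoly F a n).coeff (Fintype.card F ^ i) = a i := by
  simp only [linearizedPoly, Polynomial.finsetSum_coeff, Polynomial.coeff_C_mul,
    Polynomial.coeff_X_pow, (Nat.pow_right_injective one_lt_fieldCard).eq_iff]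
  simp [hi]

lemma exists_prod_eq_linearizedPoly_fin {A : Type*} [CommRing A] [IsDomain A] [Algebra F A] :
    ∀ (n : ℕ) (w : Fin n → A), ∃ a : ℕ → A, a n = 1 ∧
      ∏ c : Fin n → F, (Polynomial.X + Polynomial.C (∑ j, c j • w j)) = linearizedPoly F a n
  | 0, _ => ⟨fun _ => 1, rfl, by simp [linearizedPoly]⟩
  | n + 1, w => by
    obtain ⟨a, han, ha⟩ := exists_prod_eq_linearizedPoly_fin n (fun j => w j.succ)
    set D := linearizedPoly F a n with hD
    set e := D.eval (w 0)
    refine ⟨fun i => (if i = 0 then 0 else a (i - 1) ^ Fintype.card F)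
      - e ^ (Fintype.card F - 1) * (if i = n + 1 then 0 else a i), by simp [han], ?_⟩
    have key : ∏ c : Fin (n + 1) → F, (Polynomial.X + Polynomial.C (∑ j, c j • w j))
        = D ^ Fintype.card F - Polynomial.C e ^ (Fintype.card F - 1) * D := by
      rw [← prod_add_smul (F := F), ← Equiv.prod_comp (Fin.consEquiv fun _ => F),
        Fintype.prod_prod_type]
      refine Finset.prod_congr rfl fun c _ => ?_
      have h := congrArg (fun p => p.comp (Polynomial.X + Polynomial.C (c • w 0))) ha
      simp only [linearizedPoly_comp_X_add_C, eval_linearizedPoly_smul, Polynomial.prod_comp,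
        hD] at h
      rw [Polynomial.smul_C, ← h]
      refine Finset.prod_congr rfl fun c' _ => ?_
      simp [Fin.sum_univ_succ, Fin.consEquiv, add_assoc]
    rw [key]
    have hDq : D ^ Fintype.card F = ∑ i ∈ Finset.range (n + 1),
        Polynomial.C (a i ^ Fintype.card F) * Polynomial.X ^ Fintype.card F ^ (i + 1) := by
      have h := sum_pow_card_field_pow (F := F) 1 (Finset.range (n + 1))
        (fun i => Polynomial.C (a i) * Polynomial.X ^ Fintype.card F ^ i)
      rw [pow_one] at h
      rw [hD, linearizedPoly, h]
      simp [mul_pow, ← pow_mul, pow_succ]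
    simp only [linearizedPoly, map_sub, sub_mul, Finset.sum_sub_distrib]
    congr 1
    · rw [Finset.sum_range_succ', hDq]
      simp
    · rw [Finset.sum_range_succ, hD, linearizedPoly, Finset.mul_sum]
      simp only [if_true, mul_zero, map_zero, zero_mul, add_zero]
      refine Finset.sum_congr rfl fun i hi => ?_
      rw [if_neg (by have := Finset.mem_range.1 hi; omega)]
      simp [mul_assoc]

/-- The product of `t + ℓ` over all `F`-linear combinations `ℓ` of a finite family is a
linearized polynomial. -/
lemma exists_prod_eq_linearizedPoly {A ι : Type*} [CommRing A] [IsDomain A] [Algebra F A]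
    [Fintype ι] [DecidableEq ι] (w : ι → A) : ∃ a : ℕ → A, a (Fintype.card ι) = 1 ∧
      ∏ c : ι → F, (Polynomial.X + Polynomial.C (∑ j, c j • w j))
        = linearizedPoly F a (Fintype.card ι) := by
  obtain ⟨a, ha, h⟩ :=
    exists_prod_eq_linearizedPoly_fin (F := F) _ (w ∘ (Fintype.equivFin ι).symm)
  refine ⟨a, ha, h ▸ ?_⟩
  refine Fintype.prod_equiv ((Fintype.equivFin ι).arrowCongr (Equiv.refl F)) _ _ fun c => ?_
  rw [← Equiv.sum_comp (Fintype.equivFin ι).symm]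
  rfl

lemma coeff_eq_zero_of_sum_eq_zero {A ι : Type*} [CommRing A] [IsDomain A] [Algebra F A]
    [Fintype ι] {w : ι → A} (hw : LinearIndependent F w) (r : ℕ → A)
    (h : ∀ c : ι → F, ∑ i ∈ Finset.range (Fintype.card ι),
      r i * (∑ j, c j • w j) ^ Fintype.card F ^ i = 0) {i : ℕ} (hi : i < Fintype.card ι) :
    r i = 0 := by
  obtain ⟨n, hn⟩ := Nat.exists_eq_add_one.2 (Nat.zero_lt_of_lt hi)
  rw [hn] at hi
  have h0 : linearizedPoly F r n = 0 := by
    refine Polynomial.eq_zero_of_natDegree_lt_card_of_eval_eq_zero _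
      (LinearIndependent.fintypeLinearCombination_injective hw) (fun c => ?_) ?_
    · rw [eval_linearizedPoly, ← hn]
      simpa [Fintype.linearCombination_apply] using h c
    · rw [Fintype.card_fun, hn]
      refine lt_of_le_of_lt (Polynomial.natDegree_sum_le_of_forall_le (n := Fintype.card F ^ n)
        _ _ fun i hi => ?_) (Nat.pow_lt_pow_right one_lt_fieldCard n.lt_succ_self)
      refine (Polynomial.natDegree_C_mul_X_pow_le _ _).trans
        (Nat.pow_le_pow_right Fintype.card_pos ?_)
      exact Nat.lt_succ_iff.1 (Finset.mem_range.1 hi)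
  rw [← coeff_linearizedPoly (F := F) r (Nat.lt_succ_iff.1 hi), h0, Polynomial.coeff_zero]

end LinearizedPolynomials

section SteenrodDickson

variable {F : Type*} [Field F] [Fintype F]

lemma sum_mul_linearForm_pow_eq_zero {A ι : Type*} [CommRing A] [Algebra F A] [Fintype ι]
    [DecidableEq ι] {w : ι → A} {a : ℕ → A} {n : ℕ}
    (h : ∏ c : ι → F, (Polynomial.X + Polynomial.C (∑ j, c j • w j)) = linearizedPoly F a n)
    (c : ι → F) :
    ∑ i ∈ Finset.range (n + 1), a i * (∑ j, c j • w j) ^ Fintype.card F ^ i = 0 := by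
  rw [← eval_linearizedPoly, ← h, Polynomial.eval_prod]
  refine Finset.prod_eq_zero (Finset.mem_univ (-c)) ?_
  simp only [Polynomial.eval_add, Polynomial.eval_X, Polynomial.eval_C, Pi.neg_apply, neg_smul,
    Finset.sum_neg_distrib, add_neg_cancel]

/-- The action of the Steenrod operations on the Dickson invariants, written as the coefficients
of the linearized polynomial vanishing on all linear forms. -/
theorem coeff_steenrod_dickson {A ι : Type*} [CommRing A] [IsDomain A] [Algebra F A] [Fintype ι]
    [DecidableEq ι] {w : ι → A} (hw : LinearIndependent F w) (P : A →ₐ[F] Polynomial A)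
    (hP : ∀ j, P (w j) = Polynomial.C (w j)
      + Polynomial.C (w j ^ Fintype.card F) * Polynomial.X)
    (hP0 : ∀ f, (P f).coeff 0 = f) {a : ℕ → A} (ha : a (Fintype.card ι) = 1)
    (h : ∏ c : ι → F, (Polynomial.X + Polynomial.C (∑ j, c j • w j))
      = linearizedPoly F a (Fintype.card ι)) {i : ℕ} (hi : i + 1 < Fintype.card ι) :
    (P (a (i + 1))).coeff (Fintype.card F ^ i) = -a i := by
  obtain ⟨n, hn⟩ := Nat.exists_eq_add_one.2 (Nat.zero_lt_of_lt hi)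
  have hq1 : 1 < Fintype.card F := one_lt_fieldCard
  have hadd := add_pow_card_field_pow (F := F) (A := Polynomial A)
  have hsum : ∀ (S : Finset ℕ) (f : ℕ → A),
      (∑ j ∈ S, f j) ^ Fintype.card F = ∑ j ∈ S, f j ^ Fintype.card F := by
    simpa using sum_pow_card_field_pow (F := F) (A := A) (ι := ℕ) 1
  have hlin : ∀ c : ι → F, (∑ j, c j • w j) ^ Fintype.card F
      = ∑ j, c j • w j ^ Fintype.card F := fun c => by
    simpa [smul_pow, FiniteField.pow_card] using
      sum_pow_card_field_pow (F := F) 1 Finset.univ (fun j => c j • w j)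
  have hzero := fun c : ι → F => sum_mul_linearForm_pow_eq_zero h c
  obtain ⟨q, hq⟩ : ∃ q, q = Fintype.card F := ⟨_, rfl⟩
  simp only [← hq] at hq1 hadd hsum hlin hP hzero ⊢
  set T : Polynomial A := Polynomial.X with hT
  let g : ℕ → Polynomial A := fun k =>
    P (a k) * T ^ q ^ k - T ^ q ^ (n + 1) * Polynomial.C (a k ^ q)
  let β : Polynomial A := 1 + g n
  let r : ℕ → Polynomial A := fun k =>
    P (a k) - β * Polynomial.C (a k) + (if k = 0 then 0 else g (k - 1))
  have hr : r (i + 1) = 0 := by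
    refine coeff_eq_zero_of_sum_eq_zero (F := F) (w := fun j => Polynomial.C (w j)) ?_ r
      (fun c => ?_) hi
    · exact hw.map' ((Polynomial.CAlgHom : A →ₐ[F] Polynomial A).toLinearMap)
        (LinearMap.ker_eq_bot.2 Polynomial.C_injective)
    set L := ∑ j, c j • w j with hL
    have hx : ∑ j, c j • Polynomial.C (w j) = Polynomial.C L := by
      simp [hL, Polynomial.smul_C]
    have hPL : P L = Polynomial.C L + Polynomial.C (L ^ q) * T := by
      rw [hlin, hL, map_sum, map_sum, map_sum, Finset.sum_mul, ← Finset.sum_add_distrib]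
      refine Finset.sum_congr rfl fun j _ => ?_
      rw [map_smul, hP, smul_add, ← Polynomial.smul_C, ← smul_mul_assoc,
        Polynomial.smul_C, Polynomial.smul_C]
    have h0 := hzero c
    rw [hn, ← hL] at h0
    have e3 := congrArg Polynomial.C h0
    have e1 := congrArg P h0
    have e2 := congrArg (fun x => Polynomial.C (x ^ q)) h0
    have hpow : ∀ k, (L ^ q) ^ q ^ k = L ^ q ^ (k + 1) := fun k => by
      rw [← pow_mul, pow_succ']
    have hpow' : ∀ k, (L ^ q ^ k) ^ q = L ^ q ^ (k + 1) := fun k => by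
      rw [← pow_mul, pow_succ]
    simp only [hsum, mul_pow, hpow', zero_pow (Nat.ne_zero_of_lt hq1)] at e2
    simp only [map_sum, map_mul, map_pow P, hPL, hadd, mul_pow, ← map_pow Polynomial.C, hpow,
      map_zero] at e1 e2 e3
    simp only [map_pow Polynomial.C] at e1 e2 e3
    simp only [← hq]
    rw [hx, hn]
    set x := Polynomial.C L
    have haN : a (n + 1) = 1 := hn ▸ ha
    have e4 : ∑ k ∈ Finset.range (n + 1 + 1), g k * x ^ q ^ (k + 1)
        = ∑ k ∈ Finset.range (n + 1), (if k = 0 then 0 else g (k - 1)) * x ^ q ^ k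
          + g n * x ^ q ^ (n + 1) := by
      rw [Finset.sum_range_succ, Finset.sum_range_succ, Finset.sum_range_succ' _ n]
      simp [g, haN]
    have e5 : ∑ k ∈ Finset.range (n + 1 + 1), (P (a k) - β * Polynomial.C (a k)) * x ^ q ^ k
        = ∑ k ∈ Finset.range (n + 1), (P (a k) - β * Polynomial.C (a k)) * x ^ q ^ k
          - g n * x ^ q ^ (n + 1) := by
      rw [Finset.sum_range_succ]
      simp only [β, haN, map_one]
      ring
    have e6 : ∑ k ∈ Finset.range (n + 1 + 1), g k * x ^ q ^ (k + 1)
        + ∑ k ∈ Finset.range (n + 1 + 1), (P (a k) - β * Polynomial.C (a k)) * x ^ q ^ k = 0 := by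
      calc _ = ∑ k ∈ Finset.range (n + 1 + 1),
              P (a k) * (x ^ q ^ k + x ^ q ^ (k + 1) * T ^ q ^ k)
            - T ^ q ^ (n + 1) * ∑ k ∈ Finset.range (n + 1 + 1),
              Polynomial.C (a k) ^ q * x ^ q ^ (k + 1)
            - β * ∑ k ∈ Finset.range (n + 1 + 1), Polynomial.C (a k) * x ^ q ^ k := by
            simp only [Finset.mul_sum, ← Finset.sum_sub_distrib, ← Finset.sum_add_distrib]
            refine Finset.sum_congr rfl fun k _ => ?_
            simp only [g, map_pow]
            ring
        _ = 0 := by rw [e1, e2, e3]; simp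
    rw [e4, e5] at e6
    simp only [r, add_mul, Finset.sum_add_distrib]
    linear_combination e6
  have hc := congrArg (fun p => p.coeff (q ^ i)) hr
  have hin : i < n := by omega
  have hlt : q ^ i < q ^ n := Nat.pow_lt_pow_right hq1 hin
  have hlt' : q ^ i < q ^ (n + 1) := Nat.pow_lt_pow_right hq1 (by omega)
  have hpos : q ^ i ≠ 0 := pow_ne_zero _ (Nat.ne_zero_of_lt hq1)
  have hβ : β.coeff (q ^ i) = 0 := by
    simp only [β, g, hT, Polynomial.coeff_one, hpos, Polynomial.coeff_add, Polynomial.coeff_sub,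
      Polynomial.coeff_mul_X_pow',
      Polynomial.coeff_X_pow_mul', hlt.not_ge, hlt'.not_ge, if_false, sub_zero, add_zero]
  have hg : (g i).coeff (q ^ i) = a i := by
    simp [g, hT, Polynomial.coeff_mul_X_pow', Polynomial.coeff_X_pow_mul', hlt'.not_ge, hP0]
  simp only [r, Polynomial.coeff_add, Polynomial.coeff_sub, Polynomial.coeff_mul_C, hβ, zero_mul,
    sub_zero, Nat.add_sub_cancel, Nat.add_eq_zero_iff, one_ne_zero, and_false, if_false, hg,
    Polynomial.coeff_zero] at hc
  exact eq_neg_of_add_eq_zero_left hc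

end SteenrodDickson

section OrthogonalInvariants

variable {F : Type*} [Field F]

lemma stP_X (q : ℕ) {σ : Type*} (i : σ) :
    stP q σ F (X i) = Polynomial.C (X i) + Polynomial.C (X i ^ q) * Polynomial.X := by
  simp [stP]

lemma coeff_zero_stP (q : ℕ) {σ : Type*} (f : MvPolynomial σ F) : (stP q σ F f).coeff 0 = f := by
  have h : ((Polynomial.aeval (R := MvPolynomial σ F) 0).restrictScalars F).comp (stP q σ F)
      = AlgHom.id F _ := by
    refine MvPolynomial.algHom_ext fun i => ?_
    simp [stP_X]
  simpa [Polynomial.coeff_zero_eq_aeval_zero] using DFunLike.congr_fun h f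

lemma coeff_stP_sq [CharP F 2] (q : ℕ) {σ : Type*} (f : MvPolynomial σ F) (k : ℕ) :
    (stP q σ F f).coeff k ^ 2 = (stP q σ F (f ^ 2)).coeff (k * 2) := by
  rw [map_pow, ← Polynomial.map_frobenius_expand, Polynomial.coeff_map,
    Polynomial.coeff_expand_mul two_pos, frobenius_def]

/-- The ideal generated by `ξ_0, ξ_1, ξ_2, …`. -/
noncomputable def xiIdeal (q m : ℕ) (F : Type*) [Field F] : Ideal (MvPolynomial (OIdx m) F) :=
  Ideal.span (insert (xiZero m F) (Set.range (xiGen q m F)))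

lemma xiZero_mem_xiIdeal (q m : ℕ) : xiZero m F ∈ xiIdeal q m F :=
  Ideal.subset_span (Set.mem_insert _ _)

lemma xiGen_mem_xiIdeal (q m i : ℕ) : xiGen q m F i ∈ xiIdeal q m F :=
  Ideal.subset_span (Set.mem_insert_of_mem _ ⟨i, rfl⟩)

lemma deltaOne_mem_xiIdeal (q m : ℕ) : deltaOne q m F ∈ xiIdeal q m F := by
  refine sum_mem fun j _ => sum_mem fun k _ => ?_
  split_ifs
  · exact Ideal.mul_mem_right _ _ (Ideal.mul_mem_right _ _ (xiGen_mem_xiIdeal q m j))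
  · exact zero_mem _

lemma xiGen_zero [CharP F 2] (q m : ℕ) : xiGen q m F 0 = 0 := by
  refine Finset.sum_eq_zero fun j _ => ?_
  rw [mul_comm (X (some (Sum.inl j)))]
  simpa using CharTwo.add_self_eq_zero _

variable [Fintype F]

lemma stP_xiGen_succ (m i : ℕ) :
    stP (Fintype.card F) (OIdx m) F (xiGen (Fintype.card F) m F (i + 1))
      = Polynomial.C (xiGen (Fintype.card F) m F (i + 1))
        + Polynomial.C (xiGen (Fintype.card F) m F (i + 2))
          * Polynomial.X ^ Fintype.card F ^ (i + 1)
        + Polynomial.C (xiGen (Fintype.card F) m F i ^ Fintype.card F) * Polynomial.X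
        + Polynomial.C (xiGen (Fintype.card F) m F (i + 1) ^ Fintype.card F)
          * Polynomial.X ^ (Fintype.card F ^ (i + 1) + 1) := by
  have hsum := sum_pow_card_field_pow (F := F) (A := MvPolynomial (OIdx m) F) (ι := Fin m) 1
  have hadd := add_pow_card_field_pow (F := F) (A := MvPolynomial (OIdx m) F) 1
  have hadd' := add_pow_card_field_pow (F := F) (A := Polynomial (MvPolynomial (OIdx m) F))
  simp only [pow_one] at hadd hsum
  simp only [xiGen, map_add, map_sum, map_mul, map_pow, stP_X, hadd, hsum, mul_pow,
    Finset.sum_mul, hadd', ← Finset.sum_add_distrib]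
  refine Finset.sum_congr rfl fun j _ => ?_
  ring

lemma dickP_eq (m : ℕ) : dickP m F = ∏ c : (Fin m ⊕ Fin m) → F, (Polynomial.X
    + Polynomial.C (∑ i, c i • (X (some i) : MvPolynomial (OIdx m) F))) := by
  simp only [dickP, MvPolynomial.smul_eq_C_mul]

variable [CharP F 2]

lemma stP_xiZero (m : ℕ) :
    stP (Fintype.card F) (OIdx m) F (xiZero m F) = Polynomial.C (xiZero m F)
      + Polynomial.C (xiGen (Fintype.card F) m F 1) * Polynomial.X
      + Polynomial.C (xiZero m F ^ Fintype.card F) * Polynomial.X ^ 2 := by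
  have hadd := add_pow_card_field_pow (F := F) (A := MvPolynomial (OIdx m) F) 1
  have hsum := sum_pow_card_field_pow (F := F) (A := MvPolynomial (OIdx m) F) (ι := Fin m) 1
  simp only [pow_one] at hadd hsum
  simp only [xiZero, xiGen, map_add, map_sum, map_mul, map_pow, stP_X, hadd, hsum, mul_pow,
    pow_one, CharTwo.add_sq, Finset.sum_mul, add_mul]
  have key : ∀ j : Fin m,
      (Polynomial.C (X (some (Sum.inr j)) : MvPolynomial (OIdx m) F)
        + Polynomial.C (X (some (Sum.inr j))) ^ Fintype.card F * Polynomial.X)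
      * (Polynomial.C (X (some (Sum.inl j)))
        + Polynomial.C (X (some (Sum.inl j))) ^ Fintype.card F * Polynomial.X)
      = Polynomial.C (X (some (Sum.inr j))) * Polynomial.C (X (some (Sum.inl j)))
        + (Polynomial.C (X (some (Sum.inr j)))
            * Polynomial.C (X (some (Sum.inl j))) ^ Fintype.card F * Polynomial.X
          + Polynomial.C (X (some (Sum.inl j)))
            * Polynomial.C (X (some (Sum.inr j))) ^ Fintype.card F * Polynomial.X)
        + Polynomial.C (X (some (Sum.inr j))) ^ Fintype.card F
          * Polynomial.C (X (some (Sum.inl j))) ^ Fintype.card F * Polynomial.X ^ 2 :=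
    fun j => by ring
  simp only [← add_mul, key, Finset.sum_add_distrib]
  ring

lemma coeff_stP_mem_xiIdeal {m : ℕ} {f : MvPolynomial (OIdx m) F}
    (hf : f ∈ xiIdeal (Fintype.card F) m F) (k : ℕ) :
    (stP (Fintype.card F) (OIdx m) F f).coeff k ∈ xiIdeal (Fintype.card F) m F := by
  have hC : ∀ {g} (p : Polynomial (MvPolynomial (OIdx m) F)), g ∈ xiIdeal (Fintype.card F) m F →
      Polynomial.C g * p ∈ Ideal.map Polynomial.C (xiIdeal (Fintype.card F) m F) :=
    fun p hg => Ideal.mul_mem_right _ _ (Ideal.mem_map_of_mem _ hg)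
  have hC' : ∀ {g}, g ∈ xiIdeal (Fintype.card F) m F →
      Polynomial.C g ∈ Ideal.map Polynomial.C (xiIdeal (Fintype.card F) m F) :=
    fun hg => Ideal.mem_map_of_mem _ hg
  have hpow : ∀ {g}, g ∈ xiIdeal (Fintype.card F) m F →
      g ^ Fintype.card F ∈ xiIdeal (Fintype.card F) m F :=
    fun hg => Ideal.pow_mem_of_mem _ hg _ Fintype.card_pos
  have hle : xiIdeal (Fintype.card F) m F ≤ (Ideal.map Polynomial.C
      (xiIdeal (Fintype.card F) m F)).comap (stP (Fintype.card F) (OIdx m) F) := by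
    have h0 := xiZero_mem_xiIdeal (F := F) (Fintype.card F) m
    have hi := xiGen_mem_xiIdeal (F := F) (Fintype.card F) m
    refine Ideal.span_le.2 ?_
    rintro _ (rfl | ⟨i, rfl⟩)
    · rw [SetLike.mem_coe, Ideal.mem_comap, stP_xiZero]
      exact add_mem (add_mem (hC' h0) (hC _ (hi _))) (hC _ (hpow h0))
    · rw [SetLike.mem_coe, Ideal.mem_comap]
      rcases i with _ | i
      · simp [xiGen_zero]
      · rw [stP_xiGen_succ]
        exact add_mem (add_mem (add_mem (hC' (hi _)) (hC _ (hi _))) (hC _ (hpow (hi _))))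
          (hC _ (hpow (hi _)))
  exact Ideal.mem_map_C_iff.1 (hle hf) k

lemma coeff_stP_dickP {m i : ℕ} (hi : i + 1 < 2 * m) :
    (stP (Fintype.card F) (OIdx m) F ((dickP m F).coeff (Fintype.card F ^ (i + 1)))).coeff
      (Fintype.card F ^ i) = (dickP m F).coeff (Fintype.card F ^ i) := by
  have hcard : Fintype.card (Fin m ⊕ Fin m) = 2 * m := by simp [two_mul]
  obtain ⟨a, ha, h⟩ := exists_prod_eq_linearizedPoly (F := F)
    (fun i : Fin m ⊕ Fin m => (X (some i) : MvPolynomial (OIdx m) F))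
  have hli : LinearIndependent F
      (fun i : Fin m ⊕ Fin m => (X (some i) : MvPolynomial (OIdx m) F)) :=
    (MvPolynomial.linearIndependent_X _ _).comp _ (Option.some_injective _)
  rw [dickP_eq, h, coeff_linearizedPoly _ (hcard ▸ hi.le),
    coeff_linearizedPoly _ (hcard ▸ (Nat.lt_of_succ_lt hi).le)]
  rw [coeff_steenrod_dickson hli _ (fun j => stP_X _ _) (coeff_zero_stP _) ha h (hcard ▸ hi),
    CharTwo.neg_eq]

/-- Modulo the `ξ_i`, the squares of the orthogonal invariants are the Dickson invariants. -/
theorem eSeq_sq_sub_mem_xiIdeal {m s : ℕ} (hs : 1 ≤ s) (hF : Fintype.card F = 2 ^ s)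
    {b1 : MvPolynomial (OIdx m) F}
    (hb1 : b1 ^ 2 = (dickP m F).coeff (Fintype.card F ^ (2 * m - 1))
      + uM (Fintype.card F) m F ^ (Fintype.card F - 2)
        * (deltaOne (Fintype.card F) m F + xiBar m F * uM1 (Fintype.card F) m F ^ Fintype.card F)) :
    ∀ k < m, eSeq (Fintype.card F) m s F b1 k ^ 2
      - (dickP m F).coeff (Fintype.card F ^ (2 * m - 1 - k)) ∈ xiIdeal (Fintype.card F) m F
  | 0, _ => by
    have h2 : 2 ^ (s - 1) * 2 = Fintype.card F := by
      rw [hF, ← pow_succ, Nat.sub_add_cancel hs]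
    have h3 : (2 ^ (s - 1) - 1) * 2 = Fintype.card F - 2 := by omega
    have hx : xiZero m F = X none ^ 2 + xiBar m F := rfl
    have : eSeq (Fintype.card F) m s F b1 0 ^ 2
        - (dickP m F).coeff (Fintype.card F ^ (2 * m - 1 - 0))
        = uM (Fintype.card F) m F ^ (Fintype.card F - 2)
          * (uM1 (Fintype.card F) m F ^ Fintype.card F * xiZero m F
            + deltaOne (Fintype.card F) m F) := by
      rw [eSeq, CharTwo.add_sq, hb1, mul_pow, mul_pow, ← pow_mul, ← pow_mul, h2, h3, hx,
        Nat.sub_zero]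
      ring
    rw [this]
    exact Ideal.mul_mem_left _ _ (add_mem (Ideal.mul_mem_left _ _ (xiZero_mem_xiIdeal _ _))
      (deltaOne_mem_xiIdeal _ _))
  | k + 1, hk => by
    have ih := eSeq_sq_sub_mem_xiIdeal hs hF hb1 k (by omega)
    have hexp : 2 ^ (s * (2 * m - 2 - k) - 1) * 2 = Fintype.card F ^ (2 * m - 1 - (k + 1)) := by
      have : 1 ≤ s * (2 * m - 2 - k) := Nat.mul_pos hs (by omega)
      rw [hF, ← pow_succ, Nat.sub_add_cancel this, ← pow_mul]
      congr 2
      omega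
    have hd := coeff_stP_dickP (F := F) (m := m) (i := 2 * m - 1 - (k + 1)) (by omega)
    rw [show 2 * m - 1 - (k + 1) + 1 = 2 * m - 1 - k by omega] at hd
    rw [eSeq, coeff_stP_sq, hexp, ← hd, ← Polynomial.coeff_sub, ← map_sub]
    exact coeff_stP_mem_xiIdeal ih _

end OrthogonalInvariants

section ZeroLocus

/-- Vectors that are pairwise orthogonal for the hyperbolic form in characteristic two span a
space of dimension at most `m`. -/
lemma not_linearIndependent_of_isotropic {K : Type*} [Field K] [CharP K 2] {m : ℕ}
    (f : Fin (m + 1) → Fin m ⊕ Fin m → K)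
    (hf : ∀ a b, ∑ j, (f a (Sum.inl j) * f b (Sum.inr j) + f a (Sum.inr j) * f b (Sum.inl j)) = 0) :
    ¬ LinearIndependent K f := by
  intro hli
  let B : LinearMap.BilinForm K (Fin m ⊕ Fin m → K) := Matrix.toBilin' (Matrix.J (Fin m) K)
  have hB : B.Nondegenerate :=
    LinearMap.BilinForm.nondegenerate_toBilin'_iff_det_ne_zero.2
      (Matrix.isUnit_det_J (Fin m) K).ne_zero
  have hBf : ∀ a b, B (f a) (f b) = 0 := fun a b => by
    rw [← hf a b]
    simp [B, Matrix.toBilin'_apply, Matrix.J, Fintype.sum_sum_type, Matrix.one_apply,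
      CharTwo.neg_eq, Finset.sum_add_distrib, add_comm]
  have hle : Submodule.span K (Set.range f) ≤ B.orthogonal (Submodule.span K (Set.range f)) := by
    refine Submodule.span_le.2 ?_
    rintro _ ⟨b, rfl⟩ x hx
    induction hx using Submodule.span_induction with
    | mem x hx => obtain ⟨a, rfl⟩ := hx; exact hBf a b
    | zero => simp
    | add x y _ _ hx hy =>
      change B (x + y) (f b) = 0
      rw [map_add, LinearMap.add_apply, hx, hy, add_zero]
    | smul c x _ hx =>
      change B (c • x) (f b) = 0
      rw [map_smul, LinearMap.smul_apply, hx, smul_zero]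
  have h1 := Submodule.finrank_mono hle
  rw [LinearMap.BilinForm.finrank_orthogonal hB, finrank_span_eq_card hli] at h1
  simp at h1
  omega

/-- The value at `w` of the symplectic form between `w` and its `i`-th Frobenius twist. -/
def symplecticTwist (F : Type*) [Fintype F] {K : Type*} [Field K] {m : ℕ} (w : Fin m ⊕ Fin m → K)
    (i : ℕ) : K :=
  ∑ j, (w (Sum.inr j) * w (Sum.inl j) ^ Fintype.card F ^ i
    + w (Sum.inl j) * w (Sum.inr j) ^ Fintype.card F ^ i)

lemma symplecticTwist_zero {F K : Type*} [Fintype F] [Field K] [CharP K 2] {m : ℕ}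
    (w : Fin m ⊕ Fin m → K) :
    symplecticTwist F w 0 = 0 := by
  refine Finset.sum_eq_zero fun j _ => ?_
  rw [mul_comm (w (Sum.inl j))]
  simpa using CharTwo.add_self_eq_zero _

variable {F K : Type*} [Field F] [Fintype F] [Field K] [Algebra F K]

lemma symplecticTwist_pow {m : ℕ} (w : Fin m ⊕ Fin m → K) (i k : ℕ) :
    symplecticTwist F w i ^ Fintype.card F ^ k =
      ∑ j, (w (Sum.inr j) ^ Fintype.card F ^ k * w (Sum.inl j) ^ Fintype.card F ^ (k + i)
        + w (Sum.inl j) ^ Fintype.card F ^ k * w (Sum.inr j) ^ Fintype.card F ^ (k + i)) := by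
  rw [symplecticTwist, sum_pow_card_field_pow]
  refine Finset.sum_congr rfl fun j _ => ?_
  rw [add_pow_card_field_pow, mul_pow, mul_pow, ← pow_mul, ← pow_mul, ← pow_add, add_comm i k]

lemma exists_frobenius_relation [CharP K 2] {m : ℕ} {w : Fin m ⊕ Fin m → K}
    (hw : ∀ i ∈ Finset.Icc 1 m, symplecticTwist F w i = 0) :
    ∃ (a : ℕ → K) (r : ℕ), r ≤ m ∧ a r ≠ 0 ∧
      ∀ j, ∑ i ∈ Finset.range (r + 1), a i * w j ^ Fintype.card F ^ i = 0 := by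
  have hw0 : ∀ i ≤ m, symplecticTwist F w i = 0 := fun i hi => by
    rcases Nat.eq_zero_or_pos i with rfl | h
    · exact symplecticTwist_zero w
    · exact hw i (Finset.mem_Icc.2 ⟨h, hi⟩)
  have hortho : ∀ a b : ℕ, a ≤ b → b ≤ m →
      ∑ j, (w (Sum.inr j) ^ Fintype.card F ^ a * w (Sum.inl j) ^ Fintype.card F ^ b
        + w (Sum.inl j) ^ Fintype.card F ^ a * w (Sum.inr j) ^ Fintype.card F ^ b) = 0 := by
    intro a b hab hb
    obtain ⟨i, rfl⟩ := Nat.exists_eq_add_of_le hab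
    rw [← symplecticTwist_pow, hw0 i (by omega), zero_pow (by simp [Fintype.card_ne_zero])]
  have hdep := not_linearIndependent_of_isotropic
    (fun (i : Fin (m + 1)) j => w j ^ Fintype.card F ^ (i : ℕ)) fun a b => by
      rcases le_total a b with h | h
      · rw [← hortho a b h (by omega)]
        exact Finset.sum_congr rfl fun j _ => by ring
      · rw [← hortho b a h (by omega)]
        exact Finset.sum_congr rfl fun j _ => by ring
  obtain ⟨g, hg, i₀, hi₀⟩ := Fintype.not_linearIndependent_iff.1 hdep
  let a : ℕ → K := fun i => if h : i < m + 1 then g ⟨i, h⟩ else 0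
  have haF : ∀ i : Fin (m + 1), a i = g i := fun i => dif_pos i.2
  have ha : a i₀ ≠ 0 := haF i₀ ▸ hi₀
  have hle : (i₀ : ℕ) ≤ m := Nat.lt_succ_iff.1 i₀.2
  refine ⟨a, Nat.findGreatest (fun i => a i ≠ 0) m, Nat.findGreatest_le m,
    Nat.findGreatest_spec (P := fun i => a i ≠ 0) hle ha, fun j => ?_⟩
  have hsum : ∑ i ∈ Finset.range (m + 1), a i * w j ^ Fintype.card F ^ i = 0 := by
    rw [Finset.sum_range]
    simpa [haF] using congrFun hg j
  refine Eq.trans (Finset.sum_subset (Finset.range_mono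
    (Nat.succ_le_succ (Nat.findGreatest_le m))) fun i hi hi' => ?_) hsum
  have h1 : ¬ a i ≠ 0 := Nat.findGreatest_is_greatest (P := fun i => a i ≠ 0) (n := m)
    (by simpa [Nat.lt_succ_iff] using hi') (by simpa [Nat.lt_succ_iff] using hi)
  rw [not_not.1 h1, zero_mul]

lemma symplecticTwist_eq_zero {m : ℕ} {w : Fin m ⊕ Fin m → K} {a : ℕ → K} {r : ℕ} (ha : a r ≠ 0)
    (h : ∀ j, ∑ i ∈ Finset.range (r + 1), a i * w j ^ Fintype.card F ^ i = 0)
    (hw : ∀ i ≤ r, symplecticTwist F w i = 0) (n : ℕ) : symplecticTwist F w n = 0 := by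
  induction n using Nat.strong_induction_on with
  | _ n ih =>
    rcases le_or_gt n r with hn | hn
    · exact hw n hn
    obtain ⟨k, rfl⟩ := Nat.exists_eq_add_of_le hn.le
    have hrel : ∀ j, ∑ i ∈ Finset.range (r + 1),
        a i ^ Fintype.card F ^ k * w j ^ Fintype.card F ^ (i + k) = 0 := fun j => by
      have := congrArg (· ^ Fintype.card F ^ k) (h j)
      simpa only [sum_pow_card_field_pow, mul_pow, ← pow_mul, ← pow_add,
        zero_pow (pow_ne_zero k (Fintype.card_ne_zero (α := F)))] using this
    have htot : ∑ i ∈ Finset.range (r + 1),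
        a i ^ Fintype.card F ^ k * symplecticTwist F w (i + k) = 0 := by
      have : ∑ j, (w (Sum.inr j) * ∑ i ∈ Finset.range (r + 1),
            a i ^ Fintype.card F ^ k * w (Sum.inl j) ^ Fintype.card F ^ (i + k)
          + w (Sum.inl j) * ∑ i ∈ Finset.range (r + 1),
            a i ^ Fintype.card F ^ k * w (Sum.inr j) ^ Fintype.card F ^ (i + k)) = 0 := by
        simp [hrel]
      rw [← this]
      simp only [symplecticTwist, Finset.mul_sum, ← Finset.sum_add_distrib]
      rw [Finset.sum_comm]
      refine Finset.sum_congr rfl fun j _ => Finset.sum_congr rfl fun i _ => ?_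
      ring
    rw [Finset.sum_range_succ, Finset.sum_eq_zero fun i hi => by
      rw [ih (i + k) (by have := Finset.mem_range.1 hi; omega), mul_zero], zero_add] at htot
    exact (mul_eq_zero.1 htot).resolve_left (pow_ne_zero _ ha)

/-- If the coordinates of `w` satisfy a linearized equation of `q`-degree `r`, they span a space
of dimension at most `r`, so at least `q ^ (dim - r)` linear forms vanish at `w`. -/
lemma card_ker_linearCombination {ι : Type*} [Fintype ι] {w : ι → K} {a : ℕ → K} {r : ℕ}
    (ha : a r ≠ 0)
    (h : ∀ j, ∑ i ∈ Finset.range (r + 1), a i * w j ^ Fintype.card F ^ i = 0) :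
    Fintype.card F ^ Fintype.card ι
      ≤ Fintype.card F ^ r * Nat.card (LinearMap.ker (Fintype.linearCombination F w)) := by
  set φ := Fintype.linearCombination F w with hφ
  have hp : linearizedPoly F a r ≠ 0 := fun h0 => ha <| by
    rw [← coeff_linearizedPoly (F := F) a le_rfl, h0, Polynomial.coeff_zero]
  have hroot : Set.range φ ⊆ (linearizedPoly F a r).roots.toFinset := by
    rintro _ ⟨c, rfl⟩
    rw [Finset.mem_coe, Multiset.mem_toFinset, Polynomial.mem_roots hp, Polynomial.IsRoot,
      eval_linearizedPoly, hφ, Fintype.linearCombination_apply]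
    simp only [sum_pow_card_field_pow, smul_pow_card_field_pow, Finset.mul_sum]
    rw [Finset.sum_comm]
    refine Finset.sum_eq_zero fun j _ => ?_
    simp only [mul_smul_comm, ← Finset.smul_sum, h j, smul_zero]
  have hdeg : (linearizedPoly F a r).natDegree ≤ Fintype.card F ^ r := by
    refine Polynomial.natDegree_sum_le_of_forall_le _ _ fun i hi => ?_
    exact (Polynomial.natDegree_C_mul_X_pow_le _ _).trans
      (Nat.pow_le_pow_right Fintype.card_pos (Nat.lt_succ_iff.1 (Finset.mem_range.1 hi)))
  have hrange : Nat.card (LinearMap.range φ) ≤ Fintype.card F ^ r := by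
    calc Nat.card (LinearMap.range φ) = (Set.range φ).ncard := rfl
      _ ≤ (linearizedPoly F a r).roots.toFinset.card := by
        rw [← Set.ncard_coe_finset]
        exact Set.ncard_le_ncard hroot (Finset.finite_toSet _)
      _ ≤ _ := (Multiset.toFinset_card_le _).trans ((Polynomial.card_roots' _).trans hdeg)
  have hcard := Submodule.card_eq_card_quotient_mul_card (LinearMap.ker φ)
  rw [Nat.card_congr φ.quotKerEquivRange.toEquiv, Nat.card_eq_fintype_card,
    Fintype.card_fun, mul_comm] at hcard
  rw [hcard]
  exact Nat.mul_le_mul_right _ hrange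

lemma X_pow_card_ker_dvd {ι : Type*} [Fintype ι] [DecidableEq ι] (w : ι → K) :
    Polynomial.X ^ Nat.card (LinearMap.ker (Fintype.linearCombination F w)) ∣
      ∏ c : ι → F, (Polynomial.X + Polynomial.C (∑ j, c j • w j)) := by
  have h : Nat.card (LinearMap.ker (Fintype.linearCombination F w))
      = (Finset.univ.filter fun c : ι → F => ∑ j, c j • w j = 0).card := by
    rw [← Fintype.card_subtype, ← Nat.card_eq_fintype_card]
    exact Nat.card_congr (Equiv.subtypeEquivRight fun c => by
      rw [LinearMap.mem_ker, Fintype.linearCombination_apply])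
  rw [h, ← Finset.prod_const]
  refine dvd_trans (dvd_of_eq (Finset.prod_congr rfl fun c hc => ?_))
    (Finset.prod_dvd_prod_of_subset _ _ _ (Finset.filter_subset _ _))
  rw [(Finset.mem_filter.1 hc).2, map_zero, add_zero]

/-- If all `ξ_i` and the top `m` Dickson invariants vanish at `w`, then `w = 0`. -/
theorem eq_zero_of_symplecticTwist_of_dickson {m : ℕ} {w : Fin m ⊕ Fin m → K} {a : ℕ → K} {r : ℕ}
    (hr : r ≤ m) (ha : a r ≠ 0)
    (h : ∀ j, ∑ i ∈ Finset.range (r + 1), a i * w j ^ Fintype.card F ^ i = 0)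
    (hd : ∀ i, m ≤ i → i < 2 * m →
      (∏ c : Fin m ⊕ Fin m → F, (Polynomial.X + Polynomial.C (∑ j, c j • w j))).coeff
        (Fintype.card F ^ i) = 0) :
    w = 0 := by
  have hcard : Fintype.card (Fin m ⊕ Fin m) = 2 * m := by simp [two_mul]
  have hker : Fintype.card F ^ m ≤ Nat.card (LinearMap.ker (Fintype.linearCombination F w)) := by
    have h1 := card_ker_linearCombination (F := F) ha h
    rw [hcard, two_mul, pow_add] at h1
    refine Nat.le_of_mul_le_mul_left (h1.trans (Nat.mul_le_mul_right _ ?_))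
      (pow_pos (Fintype.card_pos (α := F)) m)
    exact Nat.pow_le_pow_right Fintype.card_pos hr
  obtain ⟨b, hb, hprod⟩ := exists_prod_eq_linearizedPoly (F := F) w
  have hdvd := X_pow_card_ker_dvd (F := F) w
  have hzero := sum_mul_linearForm_pow_eq_zero hprod
  rw [hprod] at hd hdvd
  rw [hcard] at *
  have hbi : ∀ i < 2 * m, b i = 0 := fun i hi => by
    rw [← coeff_linearizedPoly (F := F) b hi.le]
    rcases lt_or_ge i m with him | him
    · exact Polynomial.X_pow_dvd_iff.1 hdvd _
        ((Nat.pow_lt_pow_right one_lt_fieldCard him).trans_le hker)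
    · exact hd i him hi
  funext j
  have := hzero (Pi.single j 1)
  rw [Finset.sum_range_succ, Finset.sum_eq_zero fun i hi => by
    rw [hbi i (Finset.mem_range.1 hi), zero_mul], hb, zero_add, one_mul] at this
  have h2 := pow_eq_zero_iff (pow_ne_zero _ (Fintype.card_ne_zero (α := F))) |>.1 this
  simpa [Pi.single_apply] using h2

end ZeroLocus

/-- `H = {ξ_0, ξ_1, …, ξ_m, e_1, …, e_m}` is a homogeneous system of
parameters: its zero locus over the algebraic closure is `{0}`. -/
theorem stmt_17 {F : Type*} [Field F] [Fintype F] (s m q : ℕ) (hs : 1 ≤ s)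
    (hm : 1 ≤ m) (hq : q = 2 ^ s) (hF : Fintype.card F = q)
    (b1 : MvPolynomial (OIdx m) F)
    (hb1 : b1 ^ 2 = (dickP m F).coeff (q ^ (2 * m - 1))
      + uM q m F ^ (q - 2) * (deltaOne q m F + xiBar m F * uM1 q m F ^ q))
    (v : OIdx m → AlgebraicClosure F)
    (h0 : MvPolynomial.aeval v (xiZero m F) = 0)
    (hxi : ∀ i ∈ Finset.Icc 1 m, MvPolynomial.aeval v (xiGen q m F i) = 0)
    (he : ∀ i ∈ Finset.Icc 1 m, MvPolynomial.aeval v (eSeq q m s F b1 (i - 1)) = 0) :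
    v = 0 := by
  subst hF
  have : CharP F 2 := charP_of_card_eq_prime_pow hq
  have : CharP (AlgebraicClosure F) 2 := charP_of_injective_algebraMap' F 2
  set w : Fin m ⊕ Fin m → AlgebraicClosure F := fun i => v (some i) with hw
  have hxi_eval : ∀ i, MvPolynomial.aeval v (xiGen (Fintype.card F) m F i)
      = symplecticTwist F w i := fun i => by
    simp [xiGen, symplecticTwist, hw]
  simp only [hxi_eval] at hxi
  obtain ⟨a, r, hr, ha, hrel⟩ := exists_frobenius_relation hxi
  have hall : ∀ i, symplecticTwist F w i = 0 := symplecticTwist_eq_zero ha hrel fun i hi => by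
    rcases Nat.eq_zero_or_pos i with rfl | h
    · exact symplecticTwist_zero w
    · exact hxi i (Finset.mem_Icc.2 ⟨h, hi.trans hr⟩)
  have hker : xiIdeal (Fintype.card F) m F ≤ RingHom.ker (MvPolynomial.aeval (R := F) v) := by
    refine Ideal.span_le.2 ?_
    rintro _ (rfl | ⟨i, rfl⟩)
    · exact h0
    · exact (hxi_eval i).trans (hall i)
  have hmap : (dickP m F).map (MvPolynomial.aeval (R := F) v).toRingHom
      = ∏ c : Fin m ⊕ Fin m → F, (Polynomial.X + Polynomial.C (∑ j, c j • w j)) := by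
    rw [dickP_eq, Polynomial.map_prod]
    refine Finset.prod_congr rfl fun c _ => ?_
    rw [Polynomial.map_add, Polynomial.map_X, Polynomial.map_C, AlgHom.toRingHom_eq_coe,
      RingHom.coe_coe, map_sum]
    simp only [map_smul, MvPolynomial.aeval_X, hw]
  have hw0 : w = 0 := by
    refine eq_zero_of_symplecticTwist_of_dickson hr ha hrel fun i him hi => ?_
    have hk := hker (eSeq_sq_sub_mem_xiIdeal hs hq hb1 (2 * m - 1 - i) (by omega))
    have hek := he (2 * m - 1 - i + 1) (Finset.mem_Icc.2 ⟨by omega, by omega⟩)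
    rw [Nat.add_sub_cancel] at hek
    rw [RingHom.mem_ker, map_sub, map_pow, hek, zero_pow two_ne_zero, zero_sub, neg_eq_zero,
      show 2 * m - 1 - (2 * m - 1 - i) = i by omega] at hk
    rw [← hmap, Polynomial.coeff_map]
    exact hk
  have hv : ∀ i, v (some i) = 0 := congrFun hw0
  funext i
  rcases i with _ | i
  · simpa [xiZero, hv] using h0
  · exact hv i
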